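/- Let n ∈ ℕ, r₁,…,rₙ > 0, let K be a singular kernel function satisfying the monotonicity condition (M), and let J be an upper semicontinuous n-field function. Then strict majorization cannot hold between any two node systems in the regularity set: there are no x, y ∈ Y with m_i(x) > m_i(y) for every i ∈ {0,1,…,n}. -/

import Mathlib

open Set Filter

noncomputable section

/-- A kernel function: `ℝ ∪ {−∞}`-valued (modeled as `EReal`, never `⊤`),
finite and concave on `(-1,0)` and `(0,1)`, extended continuously to `[-1,1]`. -/
structure IsKernel (K : ℝ → EReal) : Prop where
  ne_top : ∀ t, K t ≠ ⊤
  finite_off_zero : ∀ t ∈ Ioo (-1:ℝ) 1, t ≠ 0 → K t ≠ ⊥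
  concave_neg : ConcaveOn ℝ (Ioo (-1:ℝ) 0) (fun t => (K t).toReal)
  concave_pos : ConcaveOn ℝ (Ioo (0:ℝ) 1) (fun t => (K t).toReal)
  lim_zero_left : Tendsto K (nhdsWithin 0 (Iio 0)) (nhds (K 0))
  lim_zero_right : Tendsto K (nhdsWithin 0 (Ioi 0)) (nhds (K 0))
  lim_neg_one : Tendsto K (nhdsWithin (-1) (Ioi (-1))) (nhds (K (-1)))
  lim_one : Tendsto K (nhdsWithin 1 (Iio 1)) (nhds (K 1))

/-- Singularity condition `(∞)`: `K(0) = −∞`. -/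
def SingularKernel (K : ℝ → EReal) : Prop := K 0 = ⊥

/-- Monotonicity condition (M). -/
def MonotoneKernel (K : ℝ → EReal) : Prop :=
  AntitoneOn K (Ioo (-1:ℝ) 0) ∧ MonotoneOn K (Ioo (0:ℝ) 1)

/-- Strict monotonicity condition (SM). -/
def StrictMonotoneKernel (K : ℝ → EReal) : Prop :=
  StrictAntiOn K (Ico (-1:ℝ) 0) ∧ StrictMonoOn K (Ioc (0:ℝ) 1)

/-- Strict concavity of a kernel function. -/
def StrictConcaveKernel (K : ℝ → EReal) : Prop :=
  StrictConcaveOn ℝ (Ioo (-1:ℝ) 0) (fun t => (K t).toReal) ∧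
  StrictConcaveOn ℝ (Ioo (0:ℝ) 1) (fun t => (K t).toReal)

/-- An `n`-field function: bounded above, never `+∞`, finite on a set of weighted
cardinality exceeding `n` (interior points of `[0,1]` count `1`, the endpoints `1/2`). -/
def IsFieldFn (n : ℕ) (J : ℝ → EReal) : Prop :=
  (∀ t, J t ≠ ⊤) ∧ (∃ M : ℝ, ∀ t ∈ Icc (0:ℝ) 1, J t ≤ (M : EReal)) ∧
  ∃ T : Finset ℝ, (T : Set ℝ) ⊆ Icc (0:ℝ) 1 ∧ (∀ t ∈ T, J t ≠ ⊥) ∧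
    (n : ℝ) < ∑ t ∈ T, (if t = 0 ∨ t = 1 then (1/2 : ℝ) else 1)

/-- The closed simplex `S̄`. -/
def closedSimplex (n : ℕ) : Set (Fin n → ℝ) :=
  {y | Monotone y ∧ ∀ j, y j ∈ Icc (0:ℝ) 1}

/-- The open simplex `S`. -/
def openSimplex (n : ℕ) : Set (Fin n → ℝ) :=
  {y | StrictMono y ∧ ∀ j, y j ∈ Ioo (0:ℝ) 1}

/-- Extended nodes: `y₀ = 0`, `y_{n+1} = 1`. -/
def extNode {n : ℕ} (y : Fin n → ℝ) (j : Fin (n + 2)) : ℝ :=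
  if _h0 : (j : ℕ) = 0 then 0
  else if _hn : (j : ℕ) ≤ n then y ⟨(j : ℕ) - 1, by omega⟩
  else 1

/-- The interval `I_j(y) = [y_j, y_{j+1}]`, `j = 0, …, n`. -/
def nodeInterval {n : ℕ} (y : Fin n → ℝ) (j : Fin (n + 1)) : Set ℝ :=
  Icc (extNode y j.castSucc) (extNode y j.succ)

/-- The sum of translates function `F(y,t) = J(t) + ∑ⱼ rⱼ K(t - yⱼ)`. -/
def sumTrans {n : ℕ} (r : Fin n → ℝ) (K J : ℝ → EReal) (y : Fin n → ℝ) (t : ℝ) : EReal :=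
  J t + ∑ j, (r j : EReal) * K (t - y j)

/-- The interval maximum `m_j(y) = sup_{t ∈ I_j(y)} F(y,t)`. -/
def mj {n : ℕ} (r : Fin n → ℝ) (K J : ℝ → EReal) (j : Fin (n + 1)) (y : Fin n → ℝ) : EReal :=
  sSup (sumTrans r K J y '' nodeInterval y j)

/-- `m̄(y) = max_j m_j(y)`. -/
def mbar {n : ℕ} (r : Fin n → ℝ) (K J : ℝ → EReal) (y : Fin n → ℝ) : EReal :=
  ⨆ j, mj r K J j y

/-- `m̲(y) = min_j m_j(y)`. -/
def munder {n : ℕ} (r : Fin n → ℝ) (K J : ℝ → EReal) (y : Fin n → ℝ) : EReal :=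
  ⨅ j, mj r K J j y

/-- The regularity set `Y`. -/
def regSet {n : ℕ} (r : Fin n → ℝ) (K J : ℝ → EReal) : Set (Fin n → ℝ) :=
  {y ∈ openSimplex n | ∀ j, mj r K J j y ≠ ⊥}

/-- Equioscillation: all interval maxima agree. -/
def Equioscillation {n : ℕ} (r : Fin n → ℝ) (K J : ℝ → EReal) (y : Fin n → ℝ) : Prop :=
  ∀ i j : Fin (n + 1), mj r K J i y = mj r K J j y

/-- A convex function on an open set has a monotone selection of subgradients. -/
lemma ConvexOn.exists_monotoneOn_subgradient {S : Set ℝ} {f : ℝ → ℝ} (hf : ConvexOn ℝ S f)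
    (hS : IsOpen S) :
    ∃ φ : ℝ → ℝ, MonotoneOn φ S ∧ ∀ a ∈ S, ∀ b ∈ S, f a + φ a * (b - a) ≤ f b := by
  have hint := hS.interior_eq
  refine ⟨fun a => derivWithin f (Ioi a) a, ?_, fun a ha b hb => ?_⟩
  · simpa only [hint] using hf.monotoneOn_rightDeriv
  · have ha' : a ∈ interior S := by rwa [hint]
    rcases lt_trichotomy a b with hab | rfl | hab
    · have h := hf.rightDeriv_le_slope_of_mem_interior ha' hb hab
      rw [slope_def_field, le_div_iff₀ (by linarith)] at h
      linarith
    · simp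
    · have h := (hf.slope_le_leftDeriv_of_mem_interior hb ha' hab).trans
        (hf.leftDeriv_le_rightDeriv_of_mem_interior ha')
      rw [slope_def_field, div_le_iff₀ (by linarith)] at h
      linarith

/-- A concave function on an open set has an antitone selection of supergradients. -/
lemma ConcaveOn.exists_antitoneOn_supergradient {S : Set ℝ} {f : ℝ → ℝ} (hf : ConcaveOn ℝ S f)
    (hS : IsOpen S) :
    ∃ φ : ℝ → ℝ, AntitoneOn φ S ∧ ∀ a ∈ S, ∀ b ∈ S, f b ≤ f a + φ a * (b - a) := by
  obtain ⟨φ, hφ, h⟩ := hf.neg.exists_monotoneOn_subgradient hS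
  refine ⟨fun a => -φ a, hφ.neg, fun a ha b hb => ?_⟩
  have := h a ha b hb
  simp only [Pi.neg_apply] at this
  linarith

/-- Abel summation: if the partial sums of `w` peak at `i`, and `k` increases from a nonnegative
value before `i`, and increases to a nonpositive value from `i` on, then `∑ wⱼ kⱼ ≥ 0`. -/
lemma sum_mul_nonneg_of_partialSum_le {n i : ℕ} (w k : ℕ → ℝ)
    (hi : i ≤ n) (hmax : ∀ m ≤ n, ∑ l ∈ Finset.range m, w l ≤ ∑ l ∈ Finset.range i, w l)
    (hpos : ∀ j < i, 0 ≤ k j) (hneg : ∀ j, i ≤ j → j < n → k j ≤ 0)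
    (hk : ∀ j, j + 1 ≠ i → j + 1 < n → k j ≤ k (j + 1)) :
    0 ≤ ∑ j ∈ Finset.range n, w j * k j := by
  set M := ∑ l ∈ Finset.range i, w l with hM
  have key : ∀ m < n, (∑ l ∈ Finset.range m, w l - M) * k m ≤
      ∑ j ∈ Finset.range m, w j * k j := by
    intro m
    induction m with
    | zero =>
      intro h0
      rcases Nat.eq_zero_or_pos i with rfl | hi
      · simp [hM]
      · have h1 := hmax 0 (Nat.zero_le _)
        simp only [Finset.range_zero, Finset.sum_empty] at h1 ⊢
        exact mul_nonpos_of_nonpos_of_nonneg (by linarith) (hpos 0 hi)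
    | succ m ih =>
      intro hm
      have h1 := ih (by omega)
      have h2 := hmax (m + 1) hm.le
      by_cases hmi : m + 1 = i
      · rw [hmi, ← hM, sub_self, zero_mul, ← hmi, Finset.sum_range_succ]
        have : M = ∑ l ∈ Finset.range m, w l + w m := by
          rw [hM, ← hmi, Finset.sum_range_succ]
        rw [this] at h1
        linarith
      · have h3 := hk m hmi hm
        rw [Finset.sum_range_succ] at h2 ⊢
        rw [Finset.sum_range_succ]
        nlinarith [mul_nonneg (sub_nonneg.2 h2) (sub_nonneg.2 h3)]
  rcases n with _ | m
  · simp
  · have h1 := key m (Nat.lt_succ_self m)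
    have h2 := hmax (m + 1) le_rfl
    rw [Finset.sum_range_succ]
    rcases eq_or_lt_of_le hi with rfl | hlt
    · rw [hM, Finset.sum_range_succ] at h1
      linarith
    · have h0 := hneg m (by omega) (Nat.lt_succ_self m)
      rw [Finset.sum_range_succ] at h2
      nlinarith [mul_nonneg (sub_nonneg.2 h2) (neg_nonneg.2 h0)]

/-- For nodes in the open simplex, `I_i(y)` consists of the points of `[0,1]` that have exactly the
first `i` nodes on their left. -/
lemma mem_nodeInterval_iff {n : ℕ} {y : Fin n → ℝ} (hy : y ∈ openSimplex n) (i : Fin (n + 1))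
    (t : ℝ) :
    t ∈ nodeInterval y i ↔ t ∈ Icc (0 : ℝ) 1 ∧
      ∀ j : Fin n, ((j : ℕ) < i → y j ≤ t) ∧ ((i : ℕ) ≤ j → t ≤ y j) := by
  obtain ⟨hmono, h01⟩ := hy
  have hi := i.2
  simp only [nodeInterval, extNode, mem_Icc, Fin.val_castSucc, Fin.val_succ]
  constructor
  · rintro ⟨h1, h2⟩
    refine ⟨⟨?_, ?_⟩, fun j => ⟨fun hj => ?_, fun hj => ?_⟩⟩
    · split_ifs at h1 with h
      · exact h1
      · exact (h01 _).1.le.trans h1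
      · omega
    · rw [dif_neg (Nat.succ_ne_zero _)] at h2
      split_ifs at h2
      · exact h2.trans (h01 _).2.le
      · exact h2
    · rw [dif_neg (by omega), dif_pos (by omega)] at h1
      exact (hmono.monotone (Fin.le_def.2 (by simp only; omega))).trans h1
    · rw [dif_neg (by omega), dif_pos (by omega)] at h2
      exact h2.trans (hmono.monotone (Fin.le_def.2 (by simp only; omega)))
  · rintro ⟨⟨h0, h1⟩, h⟩
    constructor
    · split_ifs with h2
      · exact h0
      · exact (h _).1 (by simp only; omega)
      · omega
    · rw [dif_neg (Nat.succ_ne_zero _)]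
      split_ifs with h3
      · exact (h _).2 (by simp only; omega)
      · exact h1

/-- If `F(y,t)` is finite, so are the field and all the translates, and `t` is not a node of a
singular kernel. -/
lemma ne_bot_of_sumTrans_ne_bot {n : ℕ} {r : Fin n → ℝ} (hr : ∀ j, 0 < r j) {K J : ℝ → EReal}
    (hsing : SingularKernel K) {y : Fin n → ℝ} {t : ℝ} (h : sumTrans r K J y t ≠ ⊥) :
    J t ≠ ⊥ ∧ ∀ j, t ≠ y j := by
  rw [sumTrans, Ne, EReal.add_eq_bot_iff, not_or] at h
  refine ⟨h.1, fun j hj => h.2 ?_⟩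
  rw [← Finset.add_sum_erase _ _ (Finset.mem_univ j), EReal.add_eq_bot_iff]
  left
  rw [hj, sub_self, hsing, EReal.coe_mul_bot_of_pos (hr j)]

/-- Away from the nodes, `F(y,t)` is the real number computed from the real values. -/
lemma sumTrans_eq_coe {n : ℕ} {r : Fin n → ℝ} {K J : ℝ → EReal} {y : Fin n → ℝ} {t : ℝ}
    (hJ : J t ≠ ⊥) (hJ' : J t ≠ ⊤) (hK : ∀ j, K (t - y j) ≠ ⊥ ∧ K (t - y j) ≠ ⊤) :
    sumTrans r K J y t =
      (((J t).toReal + ∑ j, r j * (K (t - y j)).toReal : ℝ) : EReal) := by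
  have hsum (s : Finset (Fin n)) : ∑ j ∈ s, (r j : EReal) * K (t - y j) =
      ((∑ j ∈ s, r j * (K (t - y j)).toReal : ℝ) : EReal) := by
    induction s using Finset.induction_on with
    | empty => simp
    | insert a s ha ih =>
      rw [Finset.sum_insert ha, Finset.sum_insert ha, ih, EReal.coe_add, EReal.coe_mul,
        EReal.coe_toReal (hK a).2 (hK a).1]
  rw [sumTrans, hsum, EReal.coe_add, EReal.coe_toReal hJ' hJ]

/-- A monotone kernel has a nonnegative supergradient on the right of `0` and a nonpositive one on
the left, antitone on each side. -/
lemma IsKernel.exists_supergradient {K : ℝ → EReal} (hK : IsKernel K) (hmono : MonotoneKernel K) :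
    ∃ φ ψ : ℝ → ℝ, AntitoneOn φ (Ioo 0 1) ∧ AntitoneOn ψ (Ioo (-1) 0) ∧
      (∀ a ∈ Ioo (0 : ℝ) 1, 0 ≤ φ a) ∧ (∀ a ∈ Ioo (-1 : ℝ) 0, ψ a ≤ 0) ∧
      (∀ a ∈ Ioo (0 : ℝ) 1, ∀ b ∈ Ioo (0 : ℝ) 1,
        (K b).toReal ≤ (K a).toReal + φ a * (b - a)) ∧
      ∀ a ∈ Ioo (-1 : ℝ) 0, ∀ b ∈ Ioo (-1 : ℝ) 0,
        (K b).toReal ≤ (K a).toReal + ψ a * (b - a) := by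
  obtain ⟨φ, hφ, hφ'⟩ := hK.concave_pos.exists_antitoneOn_supergradient isOpen_Ioo
  obtain ⟨ψ, hψ, hψ'⟩ := hK.concave_neg.exists_antitoneOn_supergradient isOpen_Ioo
  refine ⟨φ, ψ, hφ, hψ, fun a ha => ?_, fun a ha => ?_, hφ', hψ'⟩
  · have hb : (a + 1) / 2 ∈ Ioo (0 : ℝ) 1 := ⟨by linarith [ha.1], by linarith [ha.2]⟩
    have h1 := EReal.toReal_le_toReal (hmono.2 ha hb (by linarith [ha.2]))
      (hK.finite_off_zero a ⟨by linarith [ha.1], ha.2⟩ ha.1.ne') (hK.ne_top _)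
    have h2 := hφ' a ha _ hb
    by_contra! hneg
    nlinarith [mul_pos (neg_pos.2 hneg) (show 0 < (a + 1) / 2 - a by linarith [ha.2])]
  · have hb : (a - 1) / 2 ∈ Ioo (-1 : ℝ) 0 := ⟨by linarith [ha.1], by linarith [ha.2]⟩
    have h1 := EReal.toReal_le_toReal (hmono.1 hb ha (by linarith [ha.1]))
      (hK.finite_off_zero a ⟨ha.1, by linarith [ha.2]⟩ ha.2.ne) (hK.ne_top _)
    have h2 := hψ' a ha _ hb
    by_contra! hpos
    nlinarith [mul_pos hpos (show 0 < a - (a - 1) / 2 by linarith [ha.1])]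

theorem statement14 (n : ℕ) (hn : 0 < n) (r : Fin n → ℝ) (hr : ∀ j, 0 < r j)
    (K J : ℝ → EReal) (hK : IsKernel K)
    (hsing : SingularKernel K) (hmono : MonotoneKernel K)
    (hJ : IsFieldFn n J) (hJusc : UpperSemicontinuousOn J (Icc (0:ℝ) 1)) :
    ∀ x ∈ regSet r K J, ∀ y ∈ regSet r K J,
      ¬ (∀ i : Fin (n + 1), mj r K J i y < mj r K J i x) := by
  intro x hx y hy hlt
  obtain ⟨φ, ψ, hφ, hψ, hφ0, hψ0, hφK, hψK⟩ := hK.exists_supergradient hmono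
  have hxS := hx.1
  have hyS := hy.1
  let w : ℕ → ℝ := fun j => if h : j < n then r ⟨j, h⟩ * (x ⟨j, h⟩ - y ⟨j, h⟩) else 0
  have hw (j : Fin n) : w j = r j * (x j - y j) := by simp [w]
  obtain ⟨i, hi, hmax⟩ := Finset.exists_max_image (Finset.range (n + 1))
    (fun m => ∑ l ∈ Finset.range m, w l) ⟨0, by simp⟩
  have hin : i ≤ n := Nat.lt_succ_iff.1 (Finset.mem_range.1 hi)
  replace hmax (m : ℕ) (hm : m ≤ n) := hmax m (Finset.mem_range.2 (Nat.lt_succ_of_le hm))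
  have hleft (j : Fin n) (hj : (j : ℕ) + 1 = i) : y j ≤ x j := by
    have h := hmax j j.2.le
    simp only [← hj, Finset.sum_range_succ, hw] at h
    nlinarith [hr j]
  have hright (j : Fin n) (hj : (j : ℕ) = i) : x j ≤ y j := by
    have h := hmax (j + 1) j.2
    simp only [← hj, Finset.sum_range_succ, hw] at h
    nlinarith [hr j]
  -- A point of the `i`-th interval where `F(x,t)` exceeds `m_i(y)`.
  obtain ⟨_, ⟨t, ht, rfl⟩, htlt⟩ := lt_sSup_iff.1 (hlt ⟨i, Nat.lt_succ_of_le hin⟩)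
  obtain ⟨hJbot, htx⟩ := ne_bot_of_sumTrans_ne_bot hr hsing (bot_le.trans_lt htlt).ne'
  obtain ⟨ht01, hxt⟩ := (mem_nodeInterval_iff hxS _ t).1 ht
  simp only at hxt
  have hxl (j : Fin n) (hj : (j : ℕ) < i) : x j < t := ((hxt j).1 hj).lt_of_ne (htx j).symm
  have hxr (j : Fin n) (hj : i ≤ (j : ℕ)) : t < x j := ((hxt j).2 hj).lt_of_ne (htx j)
  have hyl (j : Fin n) (hj : (j : ℕ) < i) : y j < t := by
    have hle : j ≤ ⟨i - 1, by omega⟩ := Fin.le_def.2 (by simp only; omega)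
    exact (hyS.1.monotone hle).trans_lt
      ((hleft _ (by simp only; omega)).trans_lt (hxl _ (by simp only; omega)))
  have hyr (j : Fin n) (hj : i ≤ (j : ℕ)) : t < y j := by
    have hle : ⟨i, by omega⟩ ≤ j := Fin.le_def.2 hj
    exact ((hxr _ le_rfl).trans_le (hright _ rfl)).trans_le (hyS.1.monotone hle)
  have hty : t ∈ nodeInterval y ⟨i, Nat.lt_succ_of_le hin⟩ :=
    (mem_nodeInterval_iff hyS _ t).2
      ⟨ht01, fun j => ⟨fun hj => (hyl j hj).le, fun hj => (hyr j hj).le⟩⟩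
  have hFlt : sumTrans r K J y t < sumTrans r K J x t :=
    (le_sSup (mem_image_of_mem _ hty)).trans_lt htlt
  have hpos {z : Fin n → ℝ} (hz : z ∈ openSimplex n) (j : Fin n) (h : z j < t) :
      t - z j ∈ Ioo (0 : ℝ) 1 := ⟨by linarith, by linarith [(hz.2 j).1, ht01.2]⟩
  have hneg {z : Fin n → ℝ} (hz : z ∈ openSimplex n) (j : Fin n) (h : t < z j) :
      t - z j ∈ Ioo (-1 : ℝ) 0 := ⟨by linarith [(hz.2 j).2, ht01.1], by linarith⟩
  have hfin {z : Fin n → ℝ} (hz : z ∈ openSimplex n) (hne : ∀ j, t ≠ z j) (j : Fin n) :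
      K (t - z j) ≠ ⊥ ∧ K (t - z j) ≠ ⊤ :=
    ⟨hK.finite_off_zero _ ⟨by linarith [(hz.2 j).2, ht01.1], by linarith [(hz.2 j).1, ht01.2]⟩
      (sub_ne_zero.2 (hne j)), hK.ne_top _⟩
  have hyne (j : Fin n) : t ≠ y j := by
    rcases lt_or_ge (j : ℕ) i with h | h
    · exact (hyl j h).ne'
    · exact (hyr j h).ne
  rw [sumTrans_eq_coe hJbot (hJ.1 t) (hfin hyS hyne),
    sumTrans_eq_coe hJbot (hJ.1 t) (hfin hxS htx), EReal.coe_lt_coe_iff] at hFlt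
  -- The slopes of the translates at `t`.
  let k : ℕ → ℝ := fun j => if h : j < n then
    (if j < i then φ (t - y ⟨j, h⟩) else ψ (t - y ⟨j, h⟩)) else 0
  have hkl (j : Fin n) (hj : (j : ℕ) < i) : k j = φ (t - y j) := by simp [k, hj]
  have hkr (j : Fin n) (hj : i ≤ (j : ℕ)) : k j = ψ (t - y j) := by simp [k, hj.not_gt]
  have hnonneg : 0 ≤ ∑ j ∈ Finset.range n, w j * k j := by
    refine sum_mul_nonneg_of_partialSum_le w k hin hmax (fun j hj => ?_) (fun j hj hjn => ?_)
      (fun j hj hjn => ?_)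
    · rw [hkl ⟨j, by omega⟩ hj]
      exact hφ0 _ (hpos hyS _ (hyl _ hj))
    · rw [hkr ⟨j, hjn⟩ hj]
      exact hψ0 _ (hneg hyS _ (hyr _ hj))
    · have hle : y ⟨j, by omega⟩ ≤ y ⟨j + 1, hjn⟩ :=
        hyS.1.monotone (Fin.le_def.2 (Nat.le_succ j))
      rcases lt_or_ge j i with h | h
      · have h' : j + 1 < i := by omega
        rw [hkl ⟨j, by omega⟩ h, hkl ⟨j + 1, hjn⟩ h']
        exact hφ (hpos hyS _ (hyl _ h')) (hpos hyS _ (hyl _ h)) (by linarith)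
      · have h' : i ≤ j + 1 := by omega
        rw [hkr ⟨j, by omega⟩ h, hkr ⟨j + 1, hjn⟩ h']
        exact hψ (hneg hyS _ (hyr _ h')) (hneg hyS _ (hyr _ h)) (by linarith)
  have hterm (j : Fin n) :
      r j * (K (t - x j)).toReal + w j * k j ≤ r j * (K (t - y j)).toReal := by
    have h : (K (t - x j)).toReal ≤ (K (t - y j)).toReal + k j * ((t - x j) - (t - y j)) := by
      rcases lt_or_ge (j : ℕ) i with h | h
      · rw [hkl j h]
        exact hφK _ (hpos hyS j (hyl j h)) _ (hpos hxS j (hxl j h))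
      · rw [hkr j h]
        exact hψK _ (hneg hyS j (hyr j h)) _ (hneg hxS j (hxr j h))
    rw [hw]
    nlinarith [mul_le_mul_of_nonneg_left h (hr j).le]
  have hsum := Finset.sum_le_sum fun j (_ : j ∈ Finset.univ) => hterm j
  rw [Finset.sum_add_distrib, Fin.sum_univ_eq_sum_range (fun j => w j * k j)] at hsum
  linarith
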